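/- Let (z_j)_{j≥1} be a sequence of distinct points in the open unit disc 𝔻 ⊂ ℂ. The following are equivalent: (a) for every sequence (a_j) of complex numbers with Σ_j |a_j|²·(1−|z_j|²) < ∞ there exists f ∈ H² with f(z_j) = a_j for all j; (b) for every bounded sequence (a_j) of complex numbers there exists a bounded holomorphic function f : 𝔻 → ℂ with f(z_j) = a_j for all j; (c) inf_{j≠k} |(z_j − z_k)/(1 − conj(z_k)·z_j)| > 0 and there exists C > 0 such that Σ_j (1−|z_j|²)·|f(z_j)|² ≤ C·‖f‖²_{H²} for every f ∈ H²; (d) inf_j Π_{k≠j} |(z_j − z_k)/(1 − conj(z_k)·z_j)| > 0. -/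

import Mathlib

open MeasureTheory

/-- The family of circle means appearing in the H² norm of `f`. -/
noncomputable def hardyMeans (f : ℂ → ℂ) : Set ℝ :=
  Set.range fun r : Set.Ioo (0 : ℝ) 1 =>
    (1 / (2 * Real.pi)) *
      ∫ θ in (0 : ℝ)..(2 * Real.pi), ‖f (((r : ℝ) : ℂ) * Complex.exp ((θ : ℂ) * Complex.I))‖ ^ 2

/-- Membership in the Hardy space H² of the unit disc. -/
def MemHardy2 (f : ℂ → ℂ) : Prop :=
  DifferentiableOn ℂ f (Metric.ball 0 1) ∧ BddAbove (hardyMeans f)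

/-- The squared H² norm of `f`. -/
noncomputable def hardy2NormSq (f : ℂ → ℂ) : ℝ :=
  sSup (hardyMeans f)

namespace CarlesonInterpolation

open Metric Real Filter Topology
open scoped ComplexConjugate

/-- Holomorphic functions on the unit disc whose quadratic circle means are at most `M`. -/
def boundedMeans (M : ℝ) : Set (ℂ → ℂ) :=
  {f | DifferentiableOn ℂ f (ball 0 1) ∧
    ∀ r ∈ Set.Ioo (0 : ℝ) 1, circleAverage (fun ζ => ‖f ζ‖ ^ 2) 0 r ≤ M}

theorem hardyMeans_eq (f : ℂ → ℂ) :
    hardyMeans f =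
      Set.range fun r : Set.Ioo (0 : ℝ) 1 => circleAverage (fun ζ => ‖f ζ‖ ^ 2) 0 r := by
  simp [hardyMeans, circleAverage, circleMap]

theorem memHardy2_of_mem_boundedMeans {f : ℂ → ℂ} {M : ℝ} (hf : f ∈ boundedMeans M) :
    MemHardy2 f := by
  refine ⟨hf.1, M, ?_⟩
  rw [hardyMeans_eq]
  rintro _ ⟨r, rfl⟩
  exact hf.2 r r.2

theorem hardy2NormSq_le {f : ℂ → ℂ} {M : ℝ} (hf : f ∈ boundedMeans M) :
    hardy2NormSq f ≤ M := by
  rw [hardy2NormSq, hardyMeans_eq]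
  have : Nonempty (Set.Ioo (0 : ℝ) 1) := ⟨⟨1 / 2, by norm_num, by norm_num⟩⟩
  refine csSup_le (Set.range_nonempty _) ?_
  rintro _ ⟨r, rfl⟩
  exact hf.2 r r.2

theorem mem_boundedMeans_hardy2NormSq {f : ℂ → ℂ} (hf : MemHardy2 f) :
    f ∈ boundedMeans (hardy2NormSq f) := by
  refine ⟨hf.1, fun r hr => ?_⟩
  have hb := hf.2
  rw [hardy2NormSq]
  rw [hardyMeans_eq] at hb ⊢
  exact le_csSup hb ⟨⟨r, hr⟩, rfl⟩

theorem sphere_subset_unitBall {r : ℝ} (hr : r ∈ Set.Ioo (0 : ℝ) 1) :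
    sphere (0 : ℂ) |r| ⊆ ball 0 1 := by
  rw [abs_of_pos hr.1]
  exact sphere_subset_closedBall.trans (closedBall_subset_ball hr.2)

theorem continuousOn_sphere {f : ℂ → ℂ} (hf : DifferentiableOn ℂ f (ball 0 1)) {r : ℝ}
    (hr : r ∈ Set.Ioo (0 : ℝ) 1) : ContinuousOn f (sphere 0 |r|) :=
  hf.continuousOn.mono (sphere_subset_unitBall hr)

theorem circleIntegrable_norm_sq {f : ℂ → ℂ} (hf : DifferentiableOn ℂ f (ball 0 1)) {r : ℝ}
    (hr : r ∈ Set.Ioo (0 : ℝ) 1) : CircleIntegrable (fun ζ => ‖f ζ‖ ^ 2) 0 r :=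
  ((continuousOn_sphere hf hr).norm.pow 2).circleIntegrable'

theorem norm_circleAverage_le (f : ℂ → ℂ) (c : ℂ) (r : ℝ) :
    ‖circleAverage f c r‖ ≤ circleAverage (fun ζ => ‖f ζ‖) c r := by
  rw [circleAverage, circleAverage, norm_smul, smul_eq_mul, norm_of_nonneg (by positivity)]
  gcongr
  exact intervalIntegral.norm_integral_le_integral_norm two_pi_pos.le

theorem sub_mul_norm_le_circleAverage {f : ℂ → ℂ} (hf : DifferentiableOn ℂ f (ball 0 1)) {r : ℝ}
    (hr : r ∈ Set.Ioo (0 : ℝ) 1) {w : ℂ} (hw : ‖w‖ < r) :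
    (r - ‖w‖) * ‖f w‖ ≤ circleAverage (fun ζ => ‖f ζ‖) 0 r := by
  have hsub : closedBall (0 : ℂ) |r| ⊆ ball 0 1 := by
    rw [abs_of_pos hr.1]; exact closedBall_subset_ball hr.2
  have hC := (hf.diffContOnCl_ball hsub).circleAverage_smul_div (w := w)
    (by simpa [abs_of_pos hr.1] using hw)
  have hpos : 0 < r - ‖w‖ := sub_pos.2 hw
  have hne : ∀ ζ ∈ sphere (0 : ℂ) |r|, r - ‖w‖ ≤ ‖ζ - w‖ := by
    intro ζ hζ
    rw [mem_sphere_zero_iff_norm, abs_of_pos hr.1] at hζ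
    simpa [hζ] using norm_sub_norm_le ζ w
  have hfc := continuousOn_sphere hf hr
  have key : ‖f w‖ ≤ circleAverage (fun ζ => (r - ‖w‖)⁻¹ • ‖f ζ‖) 0 r := by
    rw [← hC]
    refine (norm_circleAverage_le _ _ _).trans (circleAverage_mono ?_ ?_ ?_)
    · have hd : ContinuousOn (fun ζ => (ζ - 0) / (ζ - w)) (sphere 0 |r|) := by
        refine ContinuousOn.div (by fun_prop) (by fun_prop) fun ζ hζ h0 => ?_
        have := hne ζ hζ
        rw [h0, norm_zero] at this
        linarith
      exact (hd.smul hfc).norm.circleIntegrable'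
    · exact ((continuousOn_const (c := (r - ‖w‖)⁻¹)).smul hfc.norm).circleIntegrable'
    · intro ζ hζ
      have h1 := hne ζ hζ
      rw [mem_sphere_zero_iff_norm, abs_of_pos hr.1] at hζ
      rw [norm_smul, norm_div, sub_zero, hζ, smul_eq_mul, inv_eq_one_div]
      gcongr
      exact hr.2.le
  rw [circleAverage_fun_smul, smul_eq_mul] at key
  calc (r - ‖w‖) * ‖f w‖ ≤ (r - ‖w‖) * ((r - ‖w‖)⁻¹ * circleAverage (fun ζ => ‖f ζ‖) 0 r) := by
        gcongr
    _ = _ := by field_simp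

theorem le_of_forall_radius {M : ℝ} {g : ℝ → ℝ} (hg : Continuous g) {a : ℝ} (ha : a < 1)
    (h : ∀ r ∈ Set.Ioo a 1, g r ≤ M) : g 1 ≤ M := by
  have h1 : Tendsto g (𝓝[<] 1) (𝓝 (g 1)) := hg.continuousWithinAt
  exact le_of_tendsto h1 (mem_of_superset (Ioo_mem_nhdsLT ha) h)

theorem norm_sq_le_of_mem_boundedMeans {f : ℂ → ℂ} {M : ℝ} (hf : f ∈ boundedMeans M) {w : ℂ}
    (hw : ‖w‖ < 1) : (1 - ‖w‖) * ‖f w‖ ^ 2 ≤ M := by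
  refine le_of_forall_radius (g := fun r => (r - ‖w‖) * ‖f w‖ ^ 2) (by fun_prop) hw fun r hr => ?_
  have hr' : r ∈ Set.Ioo (0 : ℝ) 1 := ⟨(norm_nonneg w).trans_lt hr.1, hr.2⟩
  have := sub_mul_norm_le_circleAverage (hf.1.pow 2) hr' hr.1
  simp only [Pi.pow_apply, norm_pow] at this
  exact this.trans (hf.2 r hr')

theorem one_sub_conj_mul_ne_zero {w ζ : ℂ} (hw : ‖w‖ < 1) (hζ : ‖ζ‖ ≤ 1) :
    1 - conj w * ζ ≠ 0 := by
  intro h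
  have h1 : ‖conj w * ζ‖ = 1 := by rw [← sub_eq_zero.1 h, norm_one]
  rw [norm_mul, RCLike.norm_conj] at h1
  nlinarith [norm_nonneg w, norm_nonneg ζ]

theorem re_one_add_div_one_sub {u : ℂ} (hu : 1 - u ≠ 0) :
    ((1 + u) / (1 - u)).re = (1 - ‖u‖ ^ 2) * (‖1 - u‖ ^ 2)⁻¹ := by
  have h : Complex.normSq (1 - u) ≠ 0 := by simpa using hu
  rw [Complex.div_re, ← Complex.normSq_eq_norm_sq, ← Complex.normSq_eq_norm_sq]
  field_simp
  simp only [Complex.normSq_apply, Complex.add_re, Complex.sub_re, Complex.add_im, Complex.sub_im,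
    Complex.one_re, Complex.one_im]
  ring

theorem inv_one_sub_conj_mul_mem_boundedMeans {w : ℂ} (hw : ‖w‖ < 1) :
    (fun ζ => (1 - conj w * ζ)⁻¹) ∈ boundedMeans (1 - ‖w‖ ^ 2)⁻¹ := by
  have hne : ∀ ζ ∈ ball (0 : ℂ) 1, 1 - conj w * ζ ≠ 0 := fun ζ hζ =>
    one_sub_conj_mul_ne_zero hw (mem_ball_zero_iff.1 hζ).le
  refine ⟨DifferentiableOn.inv (by fun_prop) hne, fun r hr => ?_⟩
  have hq : DifferentiableOn ℂ (fun ζ => (1 + conj w * ζ) / (1 - conj w * ζ)) (ball 0 1) :=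
    DifferentiableOn.div (by fun_prop) (by fun_prop) hne
  have hsub : closedBall (0 : ℂ) |r| ⊆ ball 0 1 := by
    rw [abs_of_pos hr.1]; exact closedBall_subset_ball hr.2
  have h1 := (hq.diffContOnCl_ball hsub).circleAverage
  have h2 := Complex.reCLM.circleAverage_comp_comm
    (continuousOn_sphere hq hr).circleIntegrable'
  rw [h1] at h2
  have h3 : circleAverage (fun ζ => (1 - (‖w‖ * r) ^ 2) • ‖(1 - conj w * ζ)⁻¹‖ ^ 2) 0 r = 1 := by
    refine (circleAverage_congr_sphere fun ζ hζ => ?_).trans (h2.trans (by simp))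
    have h4 := re_one_add_div_one_sub (hne ζ (sphere_subset_unitBall hr hζ))
    rw [mem_sphere_zero_iff_norm, abs_of_pos hr.1] at hζ
    simp [h4, hζ]
  rw [circleAverage_fun_smul, smul_eq_mul] at h3
  have h5 : 0 < 1 - ‖w‖ ^ 2 := by nlinarith [norm_nonneg w]
  have h6 : 1 - ‖w‖ ^ 2 ≤ 1 - (‖w‖ * r) ^ 2 := by
    have : ‖w‖ * r ≤ ‖w‖ := mul_le_of_le_one_right (norm_nonneg w) hr.2.le
    have h0 : 0 ≤ ‖w‖ * r := mul_nonneg (norm_nonneg w) hr.1.le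
    nlinarith
  rw [eq_inv_of_mul_eq_one_right h3]
  gcongr

theorem exists_tendstoLocallyUniformlyOn {f : ℕ → ℂ → ℂ}
    (hf : ∀ n, DifferentiableOn ℂ (f n) (ball 0 1))
    (hb : ∀ r < 1, ∃ B, ∀ n w, ‖w‖ ≤ r → ‖f n w‖ ≤ B) :
    ∃ g, DifferentiableOn ℂ g (ball 0 1) ∧
      TendstoLocallyUniformlyOn f g (hyperfilter ℕ : Filter ℕ) (ball 0 1) := by
  have hlim : ∀ w : ℂ, ∃ l, ‖w‖ < 1 → Tendsto (fun n => f n w) (hyperfilter ℕ) (𝓝 l) := by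
    intro w
    by_cases hw : ‖w‖ < 1
    · obtain ⟨B, hB⟩ := hb ‖w‖ hw
      obtain ⟨l, -, hl⟩ := (isCompact_closedBall (0 : ℂ) B).ultrafilter_le_nhds'
        ((hyperfilter ℕ).map fun n => f n w)
        (Ultrafilter.mem_map.2 (Filter.univ_mem' fun n => by simpa using hB n w le_rfl))
      exact ⟨l, fun _ => hl⟩
    · exact ⟨0, fun h => absurd h hw⟩
  choose g hg using hlim
  have hloc : TendstoLocallyUniformlyOn f g (hyperfilter ℕ : Filter ℕ) (ball 0 1) := by
    rw [Metric.tendstoLocallyUniformlyOn_iff]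
    intro ε hε x hx
    have hx1 : ‖x‖ < 1 := mem_ball_zero_iff.1 hx
    set ρ := (1 - ‖x‖) / 2 with hρ
    have hρ0 : 0 < ρ := by rw [hρ]; linarith
    obtain ⟨B, hB⟩ := hb (‖x‖ + ρ) (by rw [hρ]; linarith)
    have hB0 : 0 ≤ B := (norm_nonneg _).trans (hB 0 x (by linarith))
    have hnorm : ∀ y ∈ ball x ρ, ‖y‖ ≤ ‖x‖ + ρ := fun y hy => by
      have h1 := norm_le_norm_add_norm_sub' y x
      rw [mem_ball, dist_eq_norm] at hy
      linarith
    have hball : ball x ρ ⊆ ball 0 1 := fun y hy => by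
      rw [mem_ball_zero_iff]
      have := hnorm y hy
      rw [hρ] at this
      linarith
    have hdist : ∀ n, ∀ y ∈ ball x ρ, dist (f n y) (f n x) ≤ 2 * B / ρ * dist y x := by
      intro n y hy
      refine Complex.dist_le_div_mul_dist_of_mapsTo_ball ((hf n).mono hball) (fun u hu => ?_) hy
      rw [mem_closedBall, dist_eq_norm]
      have h1 := hB n u (hnorm u hu)
      have h2 := hB n x (by linarith)
      linarith [norm_sub_le (f n u) (f n x)]
    have hdist' : ∀ y ∈ ball x ρ, dist (g y) (g x) ≤ 2 * B / ρ * dist y x := fun y hy =>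
      le_of_tendsto ((hg y (mem_ball_zero_iff.1 (hball hy))).dist (hg x hx1))
        (Eventually.of_forall fun n => hdist n y hy)
    have hη : 0 < min ρ (ε * ρ / (8 * (B + 1))) := by positivity
    refine ⟨ball x (min ρ (ε * ρ / (8 * (B + 1)))), mem_nhdsWithin_of_mem_nhds (ball_mem_nhds x hη),
      ?_⟩
    filter_upwards [Metric.tendsto_nhds.1 (hg x hx1) (ε / 4) (by positivity)] with n hn y hy
    have hy1 : y ∈ ball x ρ := ball_subset_ball (min_le_left _ _) hy
    have hy2 : 2 * B / ρ * dist y x ≤ ε / 4 := by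
      have h1 : dist y x ≤ ε * ρ / (8 * (B + 1)) := (mem_ball.1 hy).le.trans (min_le_right _ _)
      calc 2 * B / ρ * dist y x ≤ 2 * (B + 1) / ρ * (ε * ρ / (8 * (B + 1))) := by
            gcongr
            linarith
        _ = ε / 4 := by field_simp; norm_num
    have h1 := hdist n y hy1
    have h2 := hdist' y hy1
    have h3 := dist_triangle4 (g y) (g x) (f n x) (f n y)
    rw [dist_comm] at hn
    rw [dist_comm (f n y)] at h1
    linarith
  exact ⟨g, hloc.differentiableOn (Eventually.of_forall hf) isOpen_ball, hloc⟩

theorem exists_mem_boundedMeans_tendsto {f : ℕ → ℂ → ℂ} {M : ℝ} (hf : ∀ n, f n ∈ boundedMeans M) :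
    ∃ g ∈ boundedMeans M,
      ∀ w : ℂ, ‖w‖ < 1 → Tendsto (fun n => f n w) (hyperfilter ℕ) (𝓝 (g w)) := by
  obtain ⟨g, hg, hloc⟩ := exists_tendstoLocallyUniformlyOn (fun n => (hf n).1) fun r hr => by
    refine ⟨√(M / (1 - r)), fun n w hw => Real.le_sqrt_of_sq_le ?_⟩
    rw [le_div_iff₀ (by linarith)]
    have h1 := norm_sq_le_of_mem_boundedMeans (hf n) (hw.trans_lt hr)
    nlinarith [sq_nonneg ‖f n w‖]
  refine ⟨g, ⟨hg, fun r hr => ?_⟩, fun w hw => hloc.tendsto_at (mem_ball_zero_iff.2 hw)⟩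
  have hunif := (tendstoLocallyUniformlyOn_iff_forall_isCompact isOpen_ball).1 hloc _
    (sphere_subset_unitBall hr) (isCompact_sphere _ _)
  obtain ⟨B, hB⟩ := (isCompact_sphere (0 : ℂ) |r|).exists_bound_of_continuousOn
    (continuousOn_sphere hg hr)
  have hBpos : 0 ≤ |B| := abs_nonneg B
  refine le_of_forall_pos_le_add fun ε hε => ?_
  obtain ⟨n, hn⟩ := (Metric.tendstoUniformlyOn_iff.1 hunif (ε / (2 * |B| + 1))
    (by positivity)).exists
  have h1 : circleAverage (fun ζ => ‖g ζ‖ ^ 2) 0 r ≤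
      circleAverage (fun ζ => ‖f n ζ‖ ^ 2 + ε) 0 r := by
    refine circleAverage_mono (circleIntegrable_norm_sq hg hr)
      ((((continuousOn_sphere (hf n).1 hr).norm.pow 2).add continuousOn_const).circleIntegrable')
      fun ζ hζ => ?_
    have h2 := hn ζ hζ
    have h3 : ‖g ζ‖ ≤ |B| := (hB ζ hζ).trans (le_abs_self B)
    have h4 : ‖g ζ‖ - ‖f n ζ‖ ≤ ε / (2 * |B| + 1) := by
      rw [dist_eq_norm] at h2
      exact (norm_sub_norm_le _ _).trans h2.le
    have h5 : ε / (2 * |B| + 1) * (2 * |B| + 1) = ε := by field_simp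
    have h6 : 0 ≤ ε / (2 * |B| + 1) := by positivity
    have h7 := norm_nonneg (g ζ)
    have h8 := norm_nonneg (f n ζ)
    by_cases h9 : ‖g ζ‖ ≤ ‖f n ζ‖
    · nlinarith
    · push Not at h9
      nlinarith
  rw [circleAverage_fun_add (circleIntegrable_norm_sq (hf n).1 hr)
    continuousOn_const.circleIntegrable', circleAverage_const] at h1
  linarith [(hf n).2 r hr]

/-- Holomorphic functions on the unit disc bounded by `M`. -/
def boundedHolo (M : ℝ) : Set (ℂ → ℂ) :=
  {f | DifferentiableOn ℂ f (ball 0 1) ∧ ∀ w ∈ ball (0 : ℂ) 1, ‖f w‖ ≤ M}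

theorem exists_mem_boundedHolo_tendsto {f : ℕ → ℂ → ℂ} {M : ℝ} (hf : ∀ n, f n ∈ boundedHolo M) :
    ∃ g ∈ boundedHolo M,
      ∀ w : ℂ, ‖w‖ < 1 → Tendsto (fun n => f n w) (hyperfilter ℕ) (𝓝 (g w)) := by
  obtain ⟨g, hg, hloc⟩ := exists_tendstoLocallyUniformlyOn (fun n => (hf n).1) fun r hr =>
    ⟨M, fun n w hw => (hf n).2 w (mem_ball_zero_iff.2 (hw.trans_lt hr))⟩
  refine ⟨g, ⟨hg, fun w hw => ?_⟩, fun w hw => hloc.tendsto_at (mem_ball_zero_iff.2 hw)⟩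
  exact le_of_tendsto (hloc.tendsto_at hw).norm (Eventually.of_forall fun n => (hf n).2 w hw)

theorem sub_mem_boundedHolo {f g : ℂ → ℂ} {M : ℝ} (hf : f ∈ boundedHolo M)
    (hg : g ∈ boundedHolo M) : f - g ∈ boundedHolo (2 * M) :=
  ⟨hf.1.sub hg.1, fun w hw =>
    (norm_sub_le _ _).trans (by linarith [hf.2 w hw, hg.2 w hw])⟩

theorem smul_mem_boundedHolo {f : ℂ → ℂ} {M : ℝ} (c : ℂ) (hf : f ∈ boundedHolo M) :
    c • f ∈ boundedHolo (‖c‖ * M) :=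
  ⟨hf.1.const_smul c, fun w hw => by
    rw [Pi.smul_apply, norm_smul]
    gcongr
    exact hf.2 w hw⟩

theorem sub_mem_boundedMeans {f g : ℂ → ℂ} {M : ℝ} (hf : f ∈ boundedMeans M)
    (hg : g ∈ boundedMeans M) : f - g ∈ boundedMeans (4 * M) := by
  refine ⟨hf.1.sub hg.1, fun r hr => ?_⟩
  have hf2 := circleIntegrable_norm_sq hf.1 hr
  have hg2 := circleIntegrable_norm_sq hg.1 hr
  have h1 : circleAverage (fun ζ => ‖(f - g) ζ‖ ^ 2) 0 r ≤
      circleAverage (fun ζ => 2 • (‖f ζ‖ ^ 2 + ‖g ζ‖ ^ 2)) 0 r := by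
    refine circleAverage_mono (circleIntegrable_norm_sq (hf.1.sub hg.1) hr) ?_ fun ζ _ => ?_
    · have := continuousOn_sphere hf.1 hr
      have := continuousOn_sphere hg.1 hr
      exact ContinuousOn.circleIntegrable' (by fun_prop)
    · have h := norm_sub_le (f ζ) (g ζ)
      simp only [Pi.sub_apply, nsmul_eq_mul, Nat.cast_ofNat]
      nlinarith [norm_nonneg (f ζ - g ζ), sq_nonneg (‖f ζ‖ - ‖g ζ‖)]
  simp only [nsmul_eq_mul, Nat.cast_ofNat, ← smul_eq_mul (2 : ℝ)] at h1
  rw [circleAverage_fun_smul, circleAverage_fun_add hf2 hg2, smul_eq_mul] at h1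
  linarith [hf.2 r hr, hg.2 r hr]

theorem smul_mem_boundedMeans {f : ℂ → ℂ} {M : ℝ} (c : ℂ) (hf : f ∈ boundedMeans M) :
    c • f ∈ boundedMeans (‖c‖ ^ 2 * M) := by
  refine ⟨hf.1.const_smul c, fun r hr => ?_⟩
  simp only [Pi.smul_apply, norm_smul, mul_pow, ← smul_eq_mul (‖c‖ ^ 2)]
  rw [circleAverage_fun_smul]
  exact mul_le_mul_of_nonneg_left (hf.2 r hr) (by positivity)

theorem boundedMeans_mono {M N : ℝ} (h : M ≤ N) : boundedMeans M ⊆ boundedMeans N :=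
  fun _ hf => ⟨hf.1, fun r hr => (hf.2 r hr).trans h⟩

theorem boundedHolo_mono {M N : ℝ} (h : M ≤ N) : boundedHolo M ⊆ boundedHolo N :=
  fun _ hf => ⟨hf.1, fun w hw => (hf.2 w hw).trans h⟩

/-- Interpolation of all data in a Banach space is interpolation with a uniform bound, by Baire. -/
theorem exists_uniform_interpolation {E : Type*} [NormedAddCommGroup E] [NormedSpace ℂ E]
    [CompleteSpace E] {z : ℕ → ℂ} (hz : ∀ j, ‖z j‖ < 1) (T : ℕ → E →L[ℂ] ℂ)
    {K : ℝ → Set (ℂ → ℂ)} (hmono : Monotone K)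
    (hlim : ∀ (f : ℕ → ℂ → ℂ) (M : ℝ), (∀ n, f n ∈ K M) → ∃ g ∈ K M,
      ∀ w : ℂ, ‖w‖ < 1 → Tendsto (fun n => f n w) (hyperfilter ℕ) (𝓝 (g w)))
    (hsub : ∀ M, ∃ M', ∀ f ∈ K M, ∀ g ∈ K M, f - g ∈ K M')
    (hsmul : ∀ (c : ℂ) (M : ℝ), ∃ M', ∀ f ∈ K M, c • f ∈ K M')
    (hint : ∀ a : E, ∃ M, ∃ f ∈ K M, ∀ j, f (z j) = T j a) :
    ∃ M, ∀ a : E, ‖a‖ ≤ 1 → ∃ f ∈ K M, ∀ j, f (z j) = T j a := by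
  let A : ℕ → Set E := fun M => {a | ∃ f ∈ K M, ∀ j, f (z j) = T j a}
  have hclosed : ∀ M, IsClosed (A M) := by
    intro M
    refine IsSeqClosed.isClosed fun a b ha hab => ?_
    choose f hf hfa using ha
    obtain ⟨g, hg, hlg⟩ := hlim f M hf
    refine ⟨g, hg, fun j => tendsto_nhds_unique (hlg (z j) (hz j)) ?_⟩
    simp only [hfa]
    exact ((T j).continuous.tendsto b).comp (hab.mono_left Nat.hyperfilter_le_atTop)
  have hunion : ⋃ M, A M = Set.univ := by
    refine Set.eq_univ_of_forall fun a => ?_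
    obtain ⟨M, f, hf, hfa⟩ := hint a
    obtain ⟨n, hn⟩ := exists_nat_ge M
    exact Set.mem_iUnion.2 ⟨n, f, hmono hn hf, hfa⟩
  obtain ⟨N, a₀, ha₀⟩ := nonempty_interior_of_iUnion_of_closed hclosed hunion
  obtain ⟨ε, hε, hball⟩ := Metric.mem_nhds_iff.1 (mem_interior_iff_mem_nhds.1 ha₀)
  obtain ⟨M₁, hM₁⟩ := hsub N
  obtain ⟨M₂, hM₂⟩ := hsmul (((ε / 2)⁻¹ : ℝ) : ℂ) M₁
  refine ⟨M₂, fun a ha => ?_⟩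
  obtain ⟨f, hf, hfa⟩ := hball (mem_ball_self hε)
  obtain ⟨g, hg, hga⟩ : a₀ + ((ε / 2 : ℝ) : ℂ) • a ∈ A N := by
    refine hball ?_
    rw [mem_ball, dist_eq_norm, add_sub_cancel_left, norm_smul, Complex.norm_real,
      norm_of_nonneg (by positivity)]
    nlinarith
  refine ⟨_, hM₂ _ (hM₁ g hg f hf), fun j => ?_⟩
  have hε' : (ε : ℂ) ≠ 0 := by exact_mod_cast hε.ne'
  simp only [Pi.smul_apply, Pi.sub_apply, hga, hfa, map_add, map_smul, smul_eq_mul]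
  push_cast
  field_simp
  ring

theorem norm_sq_one_sub_conj_mul_sub (w ζ : ℂ) :
    ‖1 - conj w * ζ‖ ^ 2 - ‖ζ - w‖ ^ 2 = (1 - ‖w‖ ^ 2) * (1 - ‖ζ‖ ^ 2) := by
  simp only [← Complex.normSq_eq_norm_sq, Complex.normSq_apply, Complex.sub_re, Complex.sub_im,
    Complex.mul_re, Complex.mul_im, Complex.conj_re, Complex.conj_im, Complex.one_re,
    Complex.one_im]
  ring

theorem one_sub_norm_div_sq {w ζ : ℂ} (hw : ‖w‖ < 1) (hζ : ‖ζ‖ ≤ 1) :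
    1 - ‖(ζ - w) / (1 - conj w * ζ)‖ ^ 2 =
      (1 - ‖w‖ ^ 2) * (1 - ‖ζ‖ ^ 2) * ‖(1 - conj w * ζ)⁻¹‖ ^ 2 := by
  have h : ‖1 - conj w * ζ‖ ≠ 0 := norm_ne_zero_iff.2 (one_sub_conj_mul_ne_zero hw hζ)
  rw [← norm_sq_one_sub_conj_mul_sub, norm_div, norm_inv]
  generalize ‖1 - conj w * ζ‖ = t at h ⊢
  field_simp

theorem norm_div_le_one {w ζ : ℂ} (hw : ‖w‖ < 1) (hζ : ‖ζ‖ ≤ 1) :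
    ‖(ζ - w) / (1 - conj w * ζ)‖ ≤ 1 := by
  have h := one_sub_norm_div_sq hw hζ
  have h1 : 0 ≤ 1 - ‖w‖ ^ 2 := by nlinarith [norm_nonneg w]
  have h2 : 0 ≤ 1 - ‖ζ‖ ^ 2 := by nlinarith [norm_nonneg ζ]
  have h3 : 0 ≤ (1 - ‖w‖ ^ 2) * (1 - ‖ζ‖ ^ 2) * ‖(1 - conj w * ζ)⁻¹‖ ^ 2 := by positivity
  nlinarith [norm_nonneg ((ζ - w) / (1 - conj w * ζ))]

theorem one_sub_norm_le_norm_one_sub_conj_mul {w ζ : ℂ} (hζ : ‖ζ‖ ≤ 1) :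
    1 - ‖w‖ ≤ ‖1 - conj w * ζ‖ := by
  have h := norm_sub_norm_le 1 (conj w * ζ)
  rw [norm_one, norm_mul, RCLike.norm_conj] at h
  nlinarith [norm_nonneg w]

theorem exists_eq_prod_mul {z : ℕ → ℂ} (hz : ∀ j, ‖z j‖ < 1) (hinj : Function.Injective z)
    (F : Finset ℕ) {f : ℂ → ℂ} (hf : DifferentiableOn ℂ f (ball 0 1))
    (hzero : ∀ k ∈ F, f (z k) = 0) :
    ∃ g, DifferentiableOn ℂ g (ball 0 1) ∧ ∀ ζ ∈ ball (0 : ℂ) 1,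
      f ζ = (∏ k ∈ F, (ζ - z k) / (1 - conj (z k) * ζ)) * g ζ := by
  induction F using Finset.induction_on generalizing f with
  | empty => exact ⟨f, hf, by simp⟩
  | insert a F ha ih =>
    have hne : ∀ ζ ∈ ball (0 : ℂ) 1, 1 - conj (z a) * ζ ≠ 0 := fun ζ hζ =>
      one_sub_conj_mul_ne_zero (hz a) (mem_ball_zero_iff.1 hζ).le
    have hd : DifferentiableOn ℂ (dslope f (z a)) (ball 0 1) :=
      (Complex.differentiableOn_dslope (isOpen_ball.mem_nhds (by simpa using hz a))).2 hf
    have hfac : ∀ ζ ∈ ball (0 : ℂ) 1, f ζ = (ζ - z a) / (1 - conj (z a) * ζ) *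
        (dslope f (z a) ζ * (1 - conj (z a) * ζ)) := by
      intro ζ hζ
      have h1 := sub_smul_dslope f (z a) ζ
      rw [hzero a (Finset.mem_insert_self a F), sub_zero, smul_eq_mul] at h1
      have := hne ζ hζ
      rw [← h1]
      generalize 1 - conj (z a) * ζ = t at this ⊢
      field_simp
    obtain ⟨g, hg, hfg⟩ := ih (f := fun ζ => dslope f (z a) ζ * (1 - conj (z a) * ζ))
      (hd.mul (by fun_prop)) fun k hk => by
        have hk1 : z k ∈ ball (0 : ℂ) 1 := by simpa using hz k
        have h1 := hfac _ hk1
        rw [hzero k (Finset.mem_insert_of_mem hk)] at h1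
        refine (mul_eq_zero.1 h1.symm).resolve_left (div_ne_zero (sub_ne_zero.2 fun h => ?_)
          (hne _ hk1))
        exact ha (hinj h ▸ hk)
    refine ⟨g, hg, fun ζ hζ => ?_⟩
    rw [Finset.prod_insert ha, mul_assoc, ← hfg ζ hζ]
    exact hfac ζ hζ

theorem norm_sq_le_mul_prod_of_mem_boundedMeans {z : ℕ → ℂ} (hz : ∀ j, ‖z j‖ < 1)
    (hinj : Function.Injective z) (F : Finset ℕ) {f : ℂ → ℂ} {M : ℝ} (hf : f ∈ boundedMeans M)
    (hzero : ∀ k ∈ F, f (z k) = 0) {w : ℂ} (hw : ‖w‖ < 1) :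
    (1 - ‖w‖) * ‖f w‖ ^ 2 ≤ M * ∏ k ∈ F, ‖(w - z k) / (1 - conj (z k) * w)‖ ^ 2 := by
  obtain ⟨g, hg, hfg⟩ := exists_eq_prod_mul hz hinj F hf.1 hzero
  let m : ℝ → ℝ := fun r =>
    ∏ k ∈ F, max 0 (1 - (1 - ‖z k‖ ^ 2) * (1 - r ^ 2) * ((1 - ‖z k‖) ^ 2)⁻¹)
  have hm : ∀ r, 0 ≤ m r := fun r => Finset.prod_nonneg fun k _ => le_max_left _ _
  have hm1 : m 1 = 1 := by simp [m]
  have hcont : Continuous fun r => m r * ((r - ‖w‖) * ‖g w‖ ^ 2) := by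
    have : Continuous m := by
      refine continuous_finsetProd _ fun k _ => ?_
      fun_prop
    fun_prop
  have key := le_of_forall_radius (M := M) hcont hw fun r hr => by
    have hr' : r ∈ Set.Ioo (0 : ℝ) 1 := ⟨(norm_nonneg w).trans_lt hr.1, hr.2⟩
    have h1 := sub_mul_norm_le_circleAverage (hg.pow 2) hr' hr.1
    simp only [Pi.pow_apply, norm_pow] at h1
    calc m r * ((r - ‖w‖) * ‖g w‖ ^ 2) ≤ m r * circleAverage (fun ζ => ‖g ζ‖ ^ 2) 0 r :=
          mul_le_mul_of_nonneg_left h1 (hm r)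
      _ = circleAverage (fun ζ => m r • ‖g ζ‖ ^ 2) 0 r := by
          rw [circleAverage_fun_smul, smul_eq_mul]
      _ ≤ circleAverage (fun ζ => ‖f ζ‖ ^ 2) 0 r := by
          refine circleAverage_mono (((continuousOn_const (c := m r)).smul
            ((continuousOn_sphere hg hr').norm.pow 2)).circleIntegrable')
            (circleIntegrable_norm_sq hf.1 hr') fun ζ hζ => ?_
          have hζ1 := sphere_subset_unitBall hr' hζ
          have hζ2 : ‖ζ‖ ≤ 1 := (mem_ball_zero_iff.1 hζ1).le
          rw [mem_sphere_zero_iff_norm, abs_of_pos hr'.1] at hζ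
          rw [hfg ζ hζ1, norm_mul, mul_pow, norm_prod, ← Finset.prod_pow, smul_eq_mul]
          refine mul_le_mul_of_nonneg_right (Finset.prod_le_prod (fun k _ => le_max_left _ _)
            fun k _ => max_le (sq_nonneg _) ?_) (sq_nonneg _)
          have h2 := one_sub_norm_div_sq (hz k) hζ2
          have h3 : ‖(1 - conj (z k) * ζ)⁻¹‖ ^ 2 ≤ ((1 - ‖z k‖) ^ 2)⁻¹ := by
            rw [norm_inv, inv_pow]
            have h4 : 0 < 1 - ‖z k‖ := sub_pos.2 (hz k)
            gcongr
            exact one_sub_norm_le_norm_one_sub_conj_mul hζ2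
          have h5 : 0 ≤ (1 - ‖z k‖ ^ 2) * (1 - r ^ 2) := by
            have h6 : 0 ≤ 1 - ‖z k‖ ^ 2 := by nlinarith [norm_nonneg (z k), hz k]
            have h7 : 0 ≤ 1 - r ^ 2 := by nlinarith [hr'.1, hr'.2]
            positivity
          rw [hζ] at h2
          linarith [mul_le_mul_of_nonneg_left h3 h5]
      _ ≤ M := hf.2 r hr'
  simp only [hm1, one_mul] at key
  rw [hfg w (mem_ball_zero_iff.2 hw), norm_mul, mul_pow, norm_prod, ← Finset.prod_pow]
  calc _ = ((1 - ‖w‖) * ‖g w‖ ^ 2) * ∏ k ∈ F, ‖(w - z k) / (1 - conj (z k) * w)‖ ^ 2 := by ring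
    _ ≤ _ := by gcongr

/-- Strong separation from one function per point, vanishing at the other points. -/
theorem strongSeparation_of_boundedMeans {z : ℕ → ℂ} (hz : ∀ j, ‖z j‖ < 1)
    (hinj : Function.Injective z) {M : ℝ}
    (h : ∀ j, ∃ f ∈ boundedMeans M, 1 ≤ (1 - ‖z j‖ ^ 2) * ‖f (z j)‖ ^ 2 ∧
      ∀ k, k ≠ j → f (z k) = 0) :
    ∃ δ : ℝ, 0 < δ ∧ ∀ j, ∀ F : Finset ℕ, j ∉ F →
      δ ≤ ∏ k ∈ F, ‖(z j - z k) / (1 - conj (z k) * z j)‖ := by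
  have key : ∀ j, ∀ F : Finset ℕ, j ∉ F →
      1 ≤ 2 * M * ∏ k ∈ F, ‖(z j - z k) / (1 - conj (z k) * z j)‖ ^ 2 := by
    intro j F hjF
    obtain ⟨f, hf, hfj, hfk⟩ := h j
    have h1 := norm_sq_le_mul_prod_of_mem_boundedMeans hz hinj F hf
      (fun k hk => hfk k (ne_of_mem_of_not_mem hk hjF)) (hz j)
    have h2 : (1 - ‖z j‖ ^ 2) * ‖f (z j)‖ ^ 2 ≤ 2 * ((1 - ‖z j‖) * ‖f (z j)‖ ^ 2) := by
      rw [← mul_assoc]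
      gcongr
      nlinarith [hz j, norm_nonneg (z j)]
    linarith
  have hM : 0 < 2 * M := by
    have := key 0 ∅ (by simp)
    simp only [Finset.prod_empty, mul_one] at this
    linarith
  refine ⟨(2 * M)⁻¹, inv_pos.2 hM, fun j F hjF => ?_⟩
  refine (?_ : (2 * M)⁻¹ ≤ ∏ k ∈ F, ‖(z j - z k) / (1 - conj (z k) * z j)‖ ^ 2).trans ?_
  · exact (inv_le_iff_one_le_mul₀' hM).2 (key j F hjF)
  · refine Finset.prod_le_prod (fun _ _ => by positivity) fun k _ => ?_
    exact pow_le_of_le_one (norm_nonneg _) (norm_div_le_one (hz k) (hz j).le) two_ne_zero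

theorem sum_mul_exp_neg_le_one_sub {ι : Type*} (p v : ι → ℝ) (F : Finset ι)
    (hp : ∀ j ∈ F, 0 ≤ p j) :
    ∑ j ∈ F, p j * Real.exp (-∑ k ∈ F with v j ≤ v k, p k) ≤
      1 - Real.exp (-∑ k ∈ F, p k) := by
  classical
  induction F using Finset.induction_on_min_value v with
  | empty => simp
  | insert a F ha hmin ih =>
    have hpF : ∀ j ∈ F, 0 ≤ p j := fun j hj => hp j (Finset.mem_insert_of_mem hj)
    have hpa : 0 ≤ p a := hp a (Finset.mem_insert_self a F)
    have hall : (insert a F).filter (fun k => v a ≤ v k) = insert a F := by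
      refine Finset.filter_true_of_mem fun k hk => ?_
      rcases Finset.mem_insert.1 hk with rfl | hk
      · exact le_rfl
      · exact hmin k hk
    have hrest : ∑ j ∈ F, p j * Real.exp (-∑ k ∈ insert a F with v j ≤ v k, p k) ≤
        ∑ j ∈ F, p j * Real.exp (-∑ k ∈ F with v j ≤ v k, p k) := by
      refine Finset.sum_le_sum fun j hj => mul_le_mul_of_nonneg_left ?_ (hpF j hj)
      refine Real.exp_le_exp.2 (neg_le_neg ?_)
      refine Finset.sum_le_sum_of_subset_of_nonneg
        (Finset.filter_subset_filter _ (Finset.subset_insert a F)) fun k hk _ => ?_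
      exact hp k (Finset.mem_filter.1 hk).1
    rw [Finset.sum_insert ha, hall, Finset.sum_insert ha]
    have h1 : p a * Real.exp (-(p a + ∑ k ∈ F, p k)) + Real.exp (-(p a + ∑ k ∈ F, p k)) ≤
        Real.exp (-∑ k ∈ F, p k) := by
      have h2 : Real.exp (-∑ k ∈ F, p k) =
          Real.exp (p a) * Real.exp (-(p a + ∑ k ∈ F, p k)) := by
        rw [← Real.exp_add]
        ring_nf
      rw [h2, ← add_one_mul]
      exact mul_le_mul_of_nonneg_right (Real.add_one_le_exp _) (Real.exp_pos _).le
    linarith [ih hpF]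

theorem sum_weights_le_of_strongSeparation {z : ℕ → ℂ} (hz : ∀ j, ‖z j‖ < 1) {δ : ℝ} (hδ : 0 < δ)
    (hd : ∀ j, ∀ F : Finset ℕ, j ∉ F →
      δ ≤ ∏ k ∈ F, ‖(z j - z k) / (1 - conj (z k) * z j)‖) (j : ℕ) (F : Finset ℕ) :
    ∑ k ∈ F, (1 - ‖z k‖ ^ 2) * (1 - ‖z j‖ ^ 2) * ‖(1 - conj (z k) * z j)⁻¹‖ ^ 2 ≤
      1 - Real.log (δ ^ 2) := by
  simp only [← one_sub_norm_div_sq (hz _) (hz j).le]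
  have h1 : ∑ k ∈ F.erase j, (1 - ‖(z j - z k) / (1 - conj (z k) * z j)‖ ^ 2) ≤
      -Real.log (δ ^ 2) := by
    rw [le_neg, Real.log_le_iff_le_exp (by positivity), ← Finset.sum_neg_distrib, Real.exp_sum]
    calc δ ^ 2 ≤ (∏ k ∈ F.erase j, ‖(z j - z k) / (1 - conj (z k) * z j)‖) ^ 2 := by
          gcongr
          exact hd j _ (Finset.notMem_erase j F)
      _ ≤ _ := by
          rw [← Finset.prod_pow]
          gcongr with k _
          linarith [Real.add_one_le_exp (-(1 - ‖(z j - z k) / (1 - conj (z k) * z j)‖ ^ 2))]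
  by_cases hj : j ∈ F
  · rw [← Finset.add_sum_erase F _ hj]
    simp only [sub_self, zero_div, norm_zero]
    linarith
  · rw [Finset.erase_eq_of_notMem hj] at h1
    linarith

/-- The interpolating functions of P. Jones for the point `z j` among the points `z k`, `k ∈ F`. -/
noncomputable def jones (z : ℕ → ℂ) (F : Finset ℕ) (j : ℕ) (ζ : ℂ) : ℂ :=
  (∏ k ∈ F.erase j, (ζ - z k) / (1 - conj (z k) * ζ)) /
    (∏ k ∈ F.erase j, (z j - z k) / (1 - conj (z k) * z j)) *
  (((1 - ‖z j‖ ^ 2 : ℝ) : ℂ) * (1 - conj (z j) * ζ)⁻¹) ^ 2 *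
  Complex.exp (∑ k ∈ F with ‖z j‖ ≤ ‖z k‖, ((1 - ‖z k‖ ^ 2 : ℝ) : ℂ) *
    ((1 + conj (z k) * z j) / (1 - conj (z k) * z j) -
      (1 + conj (z k) * ζ) / (1 - conj (z k) * ζ)))

theorem differentiableOn_jones {z : ℕ → ℂ} (hz : ∀ j, ‖z j‖ < 1) (F : Finset ℕ) (j : ℕ) :
    DifferentiableOn ℂ (jones z F j) (ball 0 1) := by
  have hne : ∀ k, ∀ ζ ∈ ball (0 : ℂ) 1, 1 - conj (z k) * ζ ≠ 0 := fun k ζ hζ =>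
    one_sub_conj_mul_ne_zero (hz k) (mem_ball_zero_iff.1 hζ).le
  have h1 : DifferentiableOn ℂ
      (fun ζ => ∏ k ∈ F.erase j, (ζ - z k) / (1 - conj (z k) * ζ)) (ball 0 1) :=
    DifferentiableOn.fun_finsetProd fun k _ =>
      DifferentiableOn.div (by fun_prop) (by fun_prop) (hne k)
  have h2 : DifferentiableOn ℂ (fun ζ => (1 - conj (z j) * ζ)⁻¹) (ball 0 1) :=
    DifferentiableOn.inv (by fun_prop) (hne j)
  have h3 : DifferentiableOn ℂ (fun ζ => ∑ k ∈ F with ‖z j‖ ≤ ‖z k‖, ((1 - ‖z k‖ ^ 2 : ℝ) : ℂ) *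
    ((1 + conj (z k) * z j) / (1 - conj (z k) * z j) -
      (1 + conj (z k) * ζ) / (1 - conj (z k) * ζ))) (ball 0 1) :=
    DifferentiableOn.fun_sum fun k _ => (DifferentiableOn.const_sub
      (DifferentiableOn.div (by fun_prop) (by fun_prop) (hne k)) _).const_mul _
  exact ((h1.div_const _).mul ((h2.const_mul _).pow 2)).mul h3.cexp

theorem jones_self {z : ℕ → ℂ} (hz : ∀ j, ‖z j‖ < 1) (hinj : Function.Injective z)
    (F : Finset ℕ) (j : ℕ) : jones z F j (z j) = 1 := by
  have h1 : ∏ k ∈ F.erase j, (z j - z k) / (1 - conj (z k) * z j) ≠ 0 :=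
    Finset.prod_ne_zero_iff.2 fun k hk => div_ne_zero
      (sub_ne_zero.2 fun h => Finset.ne_of_mem_erase hk (hinj h).symm)
      (one_sub_conj_mul_ne_zero (hz k) (hz j).le)
  have h2 : ((1 - ‖z j‖ ^ 2 : ℝ) : ℂ) = 1 - conj (z j) * z j := by
    rw [Complex.conj_mul']
    push_cast
    rfl
  rw [jones, div_self h1, h2, mul_inv_cancel₀ (one_sub_conj_mul_ne_zero (hz j) (hz j).le)]
  simp

theorem jones_of_ne {z : ℕ → ℂ} {F : Finset ℕ} {j k : ℕ} (hk : k ∈ F) (hkj : k ≠ j) :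
    jones z F j (z k) = 0 := by
  rw [jones, Finset.prod_eq_zero (Finset.mem_erase.2 ⟨hkj, hk⟩) (by simp)]
  simp

theorem sum_norm_jones_le {z : ℕ → ℂ} (hz : ∀ j, ‖z j‖ < 1) {δ : ℝ} (hδ : 0 < δ)
    (hd : ∀ j, ∀ F : Finset ℕ, j ∉ F →
      δ ≤ ∏ k ∈ F, ‖(z j - z k) / (1 - conj (z k) * z j)‖) (F : Finset ℕ) {ζ : ℂ}
    (hζ : ζ ∈ ball (0 : ℂ) 1) :
    ∑ j ∈ F, ‖jones z F j ζ‖ ≤ δ⁻¹ * Real.exp (2 * (1 - Real.log (δ ^ 2))) := by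
  have hw : ∀ j, 0 < 1 - ‖z j‖ ^ 2 := fun j => by nlinarith [norm_nonneg (z j), hz j]
  have hζ1 : ‖ζ‖ < 1 := mem_ball_zero_iff.1 hζ
  let p : ℕ → ℂ → ℝ := fun k ξ =>
    (1 - ‖z k‖ ^ 2) * ((1 + conj (z k) * ξ) / (1 - conj (z k) * ξ)).re
  have hp : ∀ k ξ, ‖ξ‖ < 1 → p k ξ =
      (1 - ‖z k‖ ^ 2) * (1 - ‖z k‖ ^ 2 * ‖ξ‖ ^ 2) * ‖(1 - conj (z k) * ξ)⁻¹‖ ^ 2 := by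
    intro k ξ hξ
    simp only [p]
    rw [re_one_add_div_one_sub (one_sub_conj_mul_ne_zero (hz k) hξ.le), norm_mul,
      RCLike.norm_conj, norm_inv]
    ring
  have hp1 : ∀ k, (1 - ‖z k‖ ^ 2) ^ 2 * ‖(1 - conj (z k) * ζ)⁻¹‖ ^ 2 ≤ p k ζ := by
    intro k
    rw [hp k ζ hζ1, sq (1 - ‖z k‖ ^ 2)]
    have h1 : ‖z k‖ ^ 2 * ‖ζ‖ ^ 2 ≤ ‖z k‖ ^ 2 :=
      mul_le_of_le_one_right (by positivity) (pow_le_one₀ (norm_nonneg _) hζ1.le)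
    have := (hw k).le
    gcongr
  have hp2 : ∀ j, ∑ k ∈ F with ‖z j‖ ≤ ‖z k‖, p k (z j) ≤ 2 * (1 - Real.log (δ ^ 2)) := by
    intro j
    calc ∑ k ∈ F with ‖z j‖ ≤ ‖z k‖, p k (z j) ≤ ∑ k ∈ F with ‖z j‖ ≤ ‖z k‖,
          2 * ((1 - ‖z k‖ ^ 2) * (1 - ‖z j‖ ^ 2) * ‖(1 - conj (z k) * z j)⁻¹‖ ^ 2) := by
          refine Finset.sum_le_sum fun k hk => ?_
          have hjk : ‖z j‖ ≤ ‖z k‖ := (Finset.mem_filter.1 hk).2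
          rw [hp k (z j) (hz j), ← mul_assoc]
          refine mul_le_mul_of_nonneg_right ?_ (sq_nonneg _)
          rw [mul_left_comm]
          refine mul_le_mul_of_nonneg_left ?_ (hw k).le
          have h1 : ‖z j‖ ^ 2 ≤ ‖z k‖ ^ 2 := by gcongr
          nlinarith [hw j, hw k, sq_nonneg ‖z j‖]
      _ ≤ _ := by
          rw [← Finset.mul_sum]
          gcongr
          exact sum_weights_le_of_strongSeparation hz hδ hd j _
  have hbound : ∀ j ∈ F, ‖jones z F j ζ‖ ≤ δ⁻¹ * Real.exp (2 * (1 - Real.log (δ ^ 2))) *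
      (p j ζ * Real.exp (-∑ k ∈ F with ‖z j‖ ≤ ‖z k‖, p k ζ)) := by
    intro j _
    have hB : ‖(∏ k ∈ F.erase j, (ζ - z k) / (1 - conj (z k) * ζ)) /
        (∏ k ∈ F.erase j, (z j - z k) / (1 - conj (z k) * z j))‖ ≤ δ⁻¹ := by
      rw [norm_div, norm_prod, norm_prod, inv_eq_one_div]
      gcongr
      · exact Finset.prod_le_one (fun _ _ => norm_nonneg _) fun k _ =>
          norm_div_le_one (hz k) hζ1.le
      · exact hd j _ (Finset.notMem_erase j F)
    have hK : ‖(((1 - ‖z j‖ ^ 2 : ℝ) : ℂ) * (1 - conj (z j) * ζ)⁻¹) ^ 2‖ ≤ p j ζ := by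
      rw [norm_pow, norm_mul, Complex.norm_real, norm_of_nonneg (hw j).le, mul_pow]
      exact hp1 j
    have hE : ‖Complex.exp (∑ k ∈ F with ‖z j‖ ≤ ‖z k‖, ((1 - ‖z k‖ ^ 2 : ℝ) : ℂ) *
        ((1 + conj (z k) * z j) / (1 - conj (z k) * z j) -
          (1 + conj (z k) * ζ) / (1 - conj (z k) * ζ)))‖ ≤
        Real.exp (2 * (1 - Real.log (δ ^ 2))) *
          Real.exp (-∑ k ∈ F with ‖z j‖ ≤ ‖z k‖, p k ζ) := by
      rw [Complex.norm_exp, ← Real.exp_add, Complex.re_sum]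
      refine Real.exp_le_exp.2 ?_
      simp only [Complex.re_ofReal_mul, Complex.sub_re, mul_sub]
      rw [Finset.sum_sub_distrib]
      linarith [hp2 j]
    rw [jones, norm_mul, norm_mul]
    have hp0 : 0 ≤ p j ζ := (norm_nonneg _).trans hK
    calc _ ≤ δ⁻¹ * p j ζ * (Real.exp (2 * (1 - Real.log (δ ^ 2))) *
          Real.exp (-∑ k ∈ F with ‖z j‖ ≤ ‖z k‖, p k ζ)) := by gcongr
      _ = _ := by ring
  refine (Finset.sum_le_sum hbound).trans ?_
  rw [← Finset.mul_sum]
  refine mul_le_of_le_one_right (by positivity) ?_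
  refine (sum_mul_exp_neg_le_one_sub (fun k => p k ζ) (fun k => ‖z k‖) F fun j _ => ?_).trans ?_
  · exact (by positivity : (0 : ℝ) ≤ _).trans (hp1 j)
  · linarith [Real.exp_pos (-∑ k ∈ F, p k ζ)]

/-- The interpolation condition for bounded holomorphic functions follows from strong separation. -/
theorem exists_boundedHolo_interpolation {z : ℕ → ℂ} (hz : ∀ j, ‖z j‖ < 1)
    (hinj : Function.Injective z) {δ : ℝ} (hδ : 0 < δ)
    (hd : ∀ j, ∀ F : Finset ℕ, j ∉ F →
      δ ≤ ∏ k ∈ F, ‖(z j - z k) / (1 - conj (z k) * z j)‖) {a : ℕ → ℂ} {A : ℝ}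
    (ha : ∀ j, ‖a j‖ ≤ A) :
    ∃ M, ∃ f ∈ boundedHolo M, ∀ j, f (z j) = a j := by
  set M := δ⁻¹ * Real.exp (2 * (1 - Real.log (δ ^ 2)))
  let f : ℕ → ℂ → ℂ := fun N ζ => ∑ j ∈ Finset.range N, a j * jones z (Finset.range N) j ζ
  have hA : 0 ≤ A := (norm_nonneg _).trans (ha 0)
  have hf : ∀ N, f N ∈ boundedHolo (A * M) := by
    refine fun N => ⟨DifferentiableOn.fun_sum fun j _ =>
      (differentiableOn_jones hz _ j).const_mul _, fun ζ hζ => ?_⟩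
    calc ‖f N ζ‖ ≤ ∑ j ∈ Finset.range N, A * ‖jones z (Finset.range N) j ζ‖ := by
          refine norm_sum_le_of_le _ fun j _ => ?_
          rw [norm_mul]
          gcongr
          exact ha j
      _ ≤ A * M := by
          rw [← Finset.mul_sum]
          gcongr
          exact sum_norm_jones_le hz hδ hd _ hζ
  obtain ⟨g, hg, hlim⟩ := exists_mem_boundedHolo_tendsto hf
  refine ⟨A * M, g, hg, fun j => tendsto_nhds_unique (hlim (z j) (hz j)) ?_⟩
  refine tendsto_const_nhds.congr' (Nat.hyperfilter_le_atTop ?_)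
  filter_upwards [eventually_gt_atTop j] with N hN
  have hj : j ∈ Finset.range N := Finset.mem_range.2 hN
  simp only [f]
  rw [Finset.sum_eq_single_of_mem j hj fun k hk hkj => by rw [jones_of_ne hj hkj.symm, mul_zero],
    jones_self hz hinj, mul_one]

/-- The interpolation condition for the Hardy space follows from strong separation. -/
theorem exists_boundedMeans_interpolation {z : ℕ → ℂ} (hz : ∀ j, ‖z j‖ < 1)
    (hinj : Function.Injective z) {δ : ℝ} (hδ : 0 < δ)
    (hd : ∀ j, ∀ F : Finset ℕ, j ∉ F →
      δ ≤ ∏ k ∈ F, ‖(z j - z k) / (1 - conj (z k) * z j)‖) {a : ℕ → ℂ}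
    (ha : Summable fun j => ‖a j‖ ^ 2 * (1 - ‖z j‖ ^ 2)) :
    ∃ M, ∃ f ∈ boundedMeans M, ∀ j, f (z j) = a j := by
  set M := δ⁻¹ * Real.exp (2 * (1 - Real.log (δ ^ 2)))
  have hM : 0 ≤ M := by positivity
  have hw : ∀ j, 0 < 1 - ‖z j‖ ^ 2 := fun j => by nlinarith [norm_nonneg (z j), hz j]
  let G : ℕ → ℂ → ℂ := fun j ζ => a j * (1 - ‖z j‖ ^ 2 : ℝ) * (1 - conj (z j) * ζ)⁻¹
  have hGd : ∀ j, DifferentiableOn ℂ (G j) (ball 0 1) := fun j =>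
    (inv_one_sub_conj_mul_mem_boundedMeans (hz j)).1.const_mul _
  have hGz : ∀ j, G j (z j) = a j := by
    intro j
    have h2 : ((1 - ‖z j‖ ^ 2 : ℝ) : ℂ) = 1 - conj (z j) * z j := by
      rw [Complex.conj_mul']
      push_cast
      rfl
    simp only [G]
    rw [h2, mul_assoc, mul_inv_cancel₀ (one_sub_conj_mul_ne_zero (hz j) (hz j).le), mul_one]
  have hGm : ∀ j, G j ∈ boundedMeans (‖a j‖ ^ 2 * (1 - ‖z j‖ ^ 2)) := by
    intro j
    have h1 := smul_mem_boundedMeans (a j * (1 - ‖z j‖ ^ 2 : ℝ))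
      (inv_one_sub_conj_mul_mem_boundedMeans (hz j))
    rw [norm_mul, Complex.norm_real, norm_of_nonneg (hw j).le, mul_pow, mul_assoc,
      sq (1 - ‖z j‖ ^ 2), mul_assoc, mul_inv_cancel₀ (hw j).ne', mul_one] at h1
    exact h1
  let f : ℕ → ℂ → ℂ := fun N ζ => ∑ j ∈ Finset.range N, G j ζ * jones z (Finset.range N) j ζ
  have hfd : ∀ N, DifferentiableOn ℂ (f N) (ball 0 1) := fun N =>
    DifferentiableOn.fun_sum fun j _ => (hGd j).mul (differentiableOn_jones hz _ j)
  have hf : ∀ N, f N ∈ boundedMeans (M ^ 2 * ∑' j, ‖a j‖ ^ 2 * (1 - ‖z j‖ ^ 2)) := by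
    refine fun N => ⟨hfd N, fun r hr => ?_⟩
    have hpt : ∀ ζ ∈ sphere (0 : ℂ) |r|,
        ‖f N ζ‖ ^ 2 ≤ M ^ 2 • ∑ j ∈ Finset.range N, ‖G j ζ‖ ^ 2 := by
      intro ζ hζ
      have hS := sum_norm_jones_le hz hδ hd (Finset.range N) (sphere_subset_unitBall hr hζ)
      have hle : ∀ j ∈ Finset.range N, ‖jones z (Finset.range N) j ζ‖ ≤ M := fun j hj =>
        (Finset.single_le_sum (f := fun j => ‖jones z (Finset.range N) j ζ‖)
          (fun _ _ => norm_nonneg _) hj).trans hS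
      calc ‖f N ζ‖ ^ 2
          ≤ (∑ j ∈ Finset.range N, ‖G j ζ‖ * ‖jones z (Finset.range N) j ζ‖) ^ 2 := by
            gcongr
            exact norm_sum_le_of_le _ fun j _ => (norm_mul _ _).le
        _ ≤ (∑ j ∈ Finset.range N, ‖jones z (Finset.range N) j ζ‖) *
            ∑ j ∈ Finset.range N, ‖jones z (Finset.range N) j ζ‖ * ‖G j ζ‖ ^ 2 :=
            Finset.sum_sq_le_sum_mul_sum_of_sq_le_mul _ (fun _ _ => norm_nonneg _)
              (fun _ _ => by positivity) fun _ _ => le_of_eq (by ring)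
        _ ≤ M * ∑ j ∈ Finset.range N, M * ‖G j ζ‖ ^ 2 := by
            gcongr with j hj
            exact hle j hj
        _ = _ := by rw [← Finset.mul_sum, smul_eq_mul]; ring
    calc circleAverage (fun ζ => ‖f N ζ‖ ^ 2) 0 r
        ≤ circleAverage (fun ζ => M ^ 2 • ∑ j ∈ Finset.range N, ‖G j ζ‖ ^ 2) 0 r := by
          refine circleAverage_mono (circleIntegrable_norm_sq (hfd N) hr) ?_ hpt
          refine ContinuousOn.circleIntegrable' ((continuousOn_const (c := M ^ 2)).smul ?_)
          exact continuousOn_finsetSum _ fun j _ => (continuousOn_sphere (hGd j) hr).norm.pow 2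
      _ = M ^ 2 * ∑ j ∈ Finset.range N, circleAverage (fun ζ => ‖G j ζ‖ ^ 2) 0 r := by
          rw [circleAverage_fun_smul, circleAverage_fun_sum fun j _ =>
            circleIntegrable_norm_sq (hGd j) hr, smul_eq_mul]
      _ ≤ M ^ 2 * ∑ j ∈ Finset.range N, ‖a j‖ ^ 2 * (1 - ‖z j‖ ^ 2) := by
          gcongr with j
          exact (hGm j).2 r hr
      _ ≤ _ := by
          gcongr
          exact ha.sum_le_tsum _ fun j _ => mul_nonneg (sq_nonneg _) (hw j).le
  obtain ⟨g, hg, hlim⟩ := exists_mem_boundedMeans_tendsto hf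
  refine ⟨_, g, hg, fun j => tendsto_nhds_unique (hlim (z j) (hz j)) ?_⟩
  refine tendsto_const_nhds.congr' (Nat.hyperfilter_le_atTop ?_)
  filter_upwards [eventually_gt_atTop j] with N hN
  have hj : j ∈ Finset.range N := Finset.mem_range.2 hN
  simp only [f]
  rw [Finset.sum_eq_single_of_mem j hj fun k hk hkj => by rw [jones_of_ne hj hkj.symm, mul_zero],
    jones_self hz hinj, mul_one, hGz]

/-- The Carleson embedding follows from strong separation. -/
theorem sum_norm_sq_le_of_strongSeparation {z : ℕ → ℂ} (hz : ∀ j, ‖z j‖ < 1)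
    (hinj : Function.Injective z) {δ : ℝ} (hδ : 0 < δ)
    (hd : ∀ j, ∀ F : Finset ℕ, j ∉ F →
      δ ≤ ∏ k ∈ F, ‖(z j - z k) / (1 - conj (z k) * z j)‖) {f : ℂ → ℂ} {H : ℝ}
    (hf : f ∈ boundedMeans H) (s : Finset ℕ) :
    ∑ j ∈ s, (1 - ‖z j‖ ^ 2) * ‖f (z j)‖ ^ 2 ≤
      2 * (δ⁻¹ * Real.exp (2 * (1 - Real.log (δ ^ 2)))) * H := by
  set M := δ⁻¹ * Real.exp (2 * (1 - Real.log (δ ^ 2)))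
  have hM : 0 ≤ M := by positivity
  have hED : ∀ j, DifferentiableOn ℂ (fun ζ => f ζ ^ 2 * jones z s j ζ) (ball 0 1) := fun j =>
    (hf.1.pow 2).mul (differentiableOn_jones hz s j)
  have key : ∀ᶠ r in 𝓝[<] (1 : ℝ), ∑ j ∈ s, (r - ‖z j‖) * ‖f (z j)‖ ^ 2 ≤ M * H := by
    have h1 : ∀ᶠ r in 𝓝[<] (1 : ℝ), ∀ j ∈ s, ‖z j‖ < r := (Finset.eventually_all s).2 fun j _ =>
      mem_of_superset (Ioo_mem_nhdsLT (hz j)) fun r hr => hr.1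
    filter_upwards [h1, Ioo_mem_nhdsLT zero_lt_one] with r hr1 hr
    calc ∑ j ∈ s, (r - ‖z j‖) * ‖f (z j)‖ ^ 2
        ≤ ∑ j ∈ s, circleAverage (fun ζ => ‖f ζ ^ 2 * jones z s j ζ‖) 0 r := by
          gcongr with j hj
          have h2 := sub_mul_norm_le_circleAverage (hED j) hr (hr1 j hj)
          rwa [jones_self hz hinj, mul_one, norm_pow] at h2
      _ = circleAverage (fun ζ => ∑ j ∈ s, ‖f ζ ^ 2 * jones z s j ζ‖) 0 r :=
          (circleAverage_fun_sum fun j _ =>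
            (continuousOn_sphere (hED j) hr).norm.circleIntegrable').symm
      _ ≤ circleAverage (fun ζ => M • ‖f ζ‖ ^ 2) 0 r := by
          refine circleAverage_mono (ContinuousOn.circleIntegrable' (continuousOn_finsetSum _
            fun j _ => (continuousOn_sphere (hED j) hr).norm))
            (((continuousOn_const (c := M)).smul
              ((continuousOn_sphere hf.1 hr).norm.pow 2)).circleIntegrable') fun ζ hζ => ?_
          simp only [norm_mul, norm_pow, smul_eq_mul]
          rw [← Finset.mul_sum, mul_comm]
          gcongr
          exact sum_norm_jones_le hz hδ hd s (sphere_subset_unitBall hr hζ)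
      _ ≤ M * H := by
          rw [circleAverage_fun_smul, smul_eq_mul]
          gcongr
          exact hf.2 r hr
  have hlim : ∑ j ∈ s, (1 - ‖z j‖) * ‖f (z j)‖ ^ 2 ≤ M * H := by
    have hc : Continuous fun r : ℝ => ∑ j ∈ s, (r - ‖z j‖) * ‖f (z j)‖ ^ 2 := by fun_prop
    exact le_of_tendsto hc.continuousWithinAt key
  calc ∑ j ∈ s, (1 - ‖z j‖ ^ 2) * ‖f (z j)‖ ^ 2
      ≤ ∑ j ∈ s, 2 * ((1 - ‖z j‖) * ‖f (z j)‖ ^ 2) := by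
        refine Finset.sum_le_sum fun j _ => ?_
        rw [← mul_assoc]
        gcongr
        nlinarith [hz j, norm_nonneg (z j)]
    _ ≤ _ := by
        rw [← Finset.mul_sum]
        linarith

/-- Strong separation follows from separation and the Carleson embedding for Szegő kernels. -/
theorem strongSeparation_of_carleson {z : ℕ → ℂ} (hz : ∀ j, ‖z j‖ < 1) {δ C : ℝ} (hδ : 0 < δ)
    (hsep : ∀ j k, j ≠ k → δ ≤ ‖(z j - z k) / (1 - conj (z k) * z j)‖) (hC : 0 < C)
    (hemb : ∀ f, MemHardy2 f → ∀ s : Finset ℕ,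
      ∑ j ∈ s, (1 - ‖z j‖ ^ 2) * ‖f (z j)‖ ^ 2 ≤ C * hardy2NormSq f) (j : ℕ) (F : Finset ℕ)
    (hj : j ∉ F) :
    Real.exp (-(C / δ ^ 2)) ≤ ∏ k ∈ F, ‖(z j - z k) / (1 - conj (z k) * z j)‖ := by
  have hw : ∀ j, 0 < 1 - ‖z j‖ ^ 2 := fun j => by nlinarith [norm_nonneg (z j), hz j]
  have hK := inv_one_sub_conj_mul_mem_boundedMeans (hz j)
  have h1 := hemb _ (memHardy2_of_mem_boundedMeans hK) F
  have h2 : ∑ k ∈ F, (1 - ‖(z j - z k) / (1 - conj (z k) * z j)‖ ^ 2) ≤ C := by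
    have h3 : ∀ k, 1 - ‖(z j - z k) / (1 - conj (z k) * z j)‖ ^ 2 = (1 - ‖z j‖ ^ 2) *
        ((1 - ‖z k‖ ^ 2) * ‖(1 - conj (z j) * z k)⁻¹‖ ^ 2) := by
      intro k
      rw [one_sub_norm_div_sq (hz k) (hz j).le, ← RCLike.norm_conj (1 - conj (z k) * z j)⁻¹]
      simp only [map_inv₀, map_sub, map_one, map_mul, Complex.conj_conj]
      rw [mul_comm (z k)]
      ring
    simp only [h3]
    rw [← Finset.mul_sum]
    have h4 := h1.trans (mul_le_mul_of_nonneg_left (hardy2NormSq_le hK) hC.le)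
    calc _ ≤ (1 - ‖z j‖ ^ 2) * (C * (1 - ‖z j‖ ^ 2)⁻¹) :=
          mul_le_mul_of_nonneg_left h4 (hw j).le
      _ = C := by have := (hw j).ne'; field_simp
  calc Real.exp (-(C / δ ^ 2))
      ≤ Real.exp (∑ k ∈ F,
          -((1 - ‖(z j - z k) / (1 - conj (z k) * z j)‖ ^ 2) / δ ^ 2)) := by
        rw [Finset.sum_neg_distrib, ← Finset.sum_div]
        gcongr
    _ = ∏ k ∈ F, Real.exp
          (-((1 - ‖(z j - z k) / (1 - conj (z k) * z j)‖ ^ 2) / δ ^ 2)) := Real.exp_sum _ _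
    _ ≤ _ := by
        refine Finset.prod_le_prod (fun _ _ => (Real.exp_pos _).le) fun k hk => ?_
        have h5 := hsep j k (ne_of_mem_of_not_mem hk hj).symm
        have h6 := norm_div_le_one (hz k) (hz j).le
        generalize ‖(z j - z k) / (1 - conj (z k) * z j)‖ = ρ at h5 h6
        have hρ : 0 < ρ := hδ.trans_le h5
        rw [← Real.le_log_iff_exp_le hρ]
        have h7 := Real.one_sub_inv_le_log_of_pos (pow_pos hρ 2)
        have h8 : Real.log (ρ ^ 2) ≤ Real.log ρ :=
          Real.log_le_log (by positivity) (pow_le_of_le_one hρ.le h6 two_ne_zero)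
        have h9 : (1 - ρ ^ 2) / ρ ^ 2 ≤ (1 - ρ ^ 2) / δ ^ 2 := by
          have : 0 ≤ 1 - ρ ^ 2 := by nlinarith
          gcongr
        have h10 : (1 - ρ ^ 2) / ρ ^ 2 = (ρ ^ 2)⁻¹ - 1 := by field_simp
        linarith

theorem strongSeparation_of_hardy_interpolation {z : ℕ → ℂ} (hz : ∀ j, ‖z j‖ < 1)
    (hinj : Function.Injective z)
    (h : ∀ a : ℕ → ℂ, Summable (fun j => ‖a j‖ ^ 2 * (1 - ‖z j‖ ^ 2)) →
      ∃ f : ℂ → ℂ, MemHardy2 f ∧ ∀ j, f (z j) = a j) :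
    ∃ δ : ℝ, 0 < δ ∧ ∀ j, ∀ F : Finset ℕ, j ∉ F →
      δ ≤ ∏ k ∈ F, ‖(z j - z k) / (1 - conj (z k) * z j)‖ := by
  have hw : ∀ j, 0 < 1 - ‖z j‖ ^ 2 := fun j => by nlinarith [norm_nonneg (z j), hz j]
  let c : ℕ → ℂ := fun j => ((√(1 - ‖z j‖ ^ 2))⁻¹ : ℝ)
  have hc : ∀ j, ‖c j‖ ^ 2 * (1 - ‖z j‖ ^ 2) = 1 := fun j => by
    simp only [c, Complex.norm_real, norm_inv, Real.norm_eq_abs, inv_pow, sq_abs,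
      Real.sq_sqrt (hw j).le]
    exact inv_mul_cancel₀ (hw j).ne'
  have hTa : ∀ (a : lp (fun _ : ℕ => ℂ) 2) j,
      (c j • lp.evalCLM ℂ (fun _ : ℕ => ℂ) 2 j) a = c j * a j := fun a j => rfl
  obtain ⟨M, hM⟩ := exists_uniform_interpolation hz
    (fun j => c j • lp.evalCLM ℂ (fun _ : ℕ => ℂ) 2 j) (K := boundedMeans)
    (fun _ _ h => boundedMeans_mono h) (fun f M hf => exists_mem_boundedMeans_tendsto hf)
    (fun M => ⟨4 * M, fun f hf g hg => sub_mem_boundedMeans hf hg⟩)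
    (fun c M => ⟨‖c‖ ^ 2 * M, fun f hf => smul_mem_boundedMeans c hf⟩) (fun a => by
      obtain ⟨f, hf, hfa⟩ := h (fun j => c j * a j) (by
        have hs := (lp.memℓp a).summable (by norm_num)
        refine hs.congr fun j => ?_
        rw [norm_mul, mul_pow, mul_right_comm, hc, one_mul]
        simp)
      exact ⟨_, f, mem_boundedMeans_hardy2NormSq hf, fun j => (hfa j).trans (hTa a j).symm⟩)
  refine strongSeparation_of_boundedMeans hz hinj (M := M) fun j => ?_
  obtain ⟨f, hf, hfj⟩ := hM (lp.single 2 j (1 : ℂ)) (by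
    rw [lp.norm_single (by norm_num)]; simp)
  refine ⟨f, hf, ?_, fun k hk => ?_⟩
  · rw [hfj, hTa, lp.single_apply_self, mul_one, mul_comm, hc]
  · rw [hfj, hTa, lp.single_apply_ne _ _ _ hk, mul_zero]

theorem strongSeparation_of_bounded_interpolation {z : ℕ → ℂ} (hz : ∀ j, ‖z j‖ < 1)
    (hinj : Function.Injective z)
    (h : ∀ a : ℕ → ℂ, BddAbove (Set.range fun j => ‖a j‖) →
      ∃ f : ℂ → ℂ, DifferentiableOn ℂ f (ball 0 1) ∧
        (∃ B : ℝ, ∀ x ∈ ball (0 : ℂ) 1, ‖f x‖ ≤ B) ∧ ∀ j, f (z j) = a j) :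
    ∃ δ : ℝ, 0 < δ ∧ ∀ j, ∀ F : Finset ℕ, j ∉ F →
      δ ≤ ∏ k ∈ F, ‖(z j - z k) / (1 - conj (z k) * z j)‖ := by
  have hw : ∀ j, 0 < 1 - ‖z j‖ ^ 2 := fun j => by nlinarith [norm_nonneg (z j), hz j]
  obtain ⟨M, hM⟩ := exists_uniform_interpolation hz
    (fun j => lp.evalCLM ℂ (fun _ : ℕ => ℂ) ⊤ j) (K := boundedHolo)
    (fun _ _ h => boundedHolo_mono h) (fun f M hf => exists_mem_boundedHolo_tendsto hf)
    (fun M => ⟨2 * M, fun f hf g hg => sub_mem_boundedHolo hf hg⟩)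
    (fun c M => ⟨‖c‖ * M, fun f hf => smul_mem_boundedHolo c hf⟩) (fun a => by
      obtain ⟨f, hf, ⟨B, hB⟩, hfa⟩ := h (fun j => a j) ⟨‖a‖, by
        rintro _ ⟨j, rfl⟩
        exact lp.norm_apply_le_norm (by norm_num) a j⟩
      exact ⟨B, f, ⟨hf, hB⟩, hfa⟩)
  refine strongSeparation_of_boundedMeans hz hinj (M := M ^ 2) fun j => ?_
  obtain ⟨f, hf, hfj⟩ := hM (lp.single ⊤ j (1 : ℂ)) (by
    rw [lp.norm_single (by norm_num)]; simp)
  have hT : ∀ (a : lp (fun _ : ℕ => ℂ) ⊤) k, lp.evalCLM ℂ (fun _ : ℕ => ℂ) ⊤ k a = a k :=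
    fun a k => rfl
  let q : ℂ → ℂ := fun ζ => (1 - conj (z j) * ζ)⁻¹
  have hq : q ∈ boundedMeans (1 - ‖z j‖ ^ 2)⁻¹ := inv_one_sub_conj_mul_mem_boundedMeans (hz j)
  have hs : ‖((√(1 - ‖z j‖ ^ 2) : ℝ) : ℂ)‖ ^ 2 = 1 - ‖z j‖ ^ 2 := by
    rw [Complex.norm_real, Real.norm_eq_abs, sq_abs, Real.sq_sqrt (hw j).le]
  have hfq : f * q ∈ boundedMeans (M ^ 2 * (1 - ‖z j‖ ^ 2)⁻¹) := by
    have hd := hf.1.mul hq.1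
    refine ⟨hd, fun r hr => ?_⟩
    calc circleAverage (fun ζ => ‖(f * q) ζ‖ ^ 2) 0 r
        ≤ circleAverage (fun ζ => M ^ 2 • ‖q ζ‖ ^ 2) 0 r := by
          refine circleAverage_mono (circleIntegrable_norm_sq hd hr) ?_ fun ζ hζ => ?_
          · exact (circleIntegrable_norm_sq hq.1 hr).const_smul
          · simp only [Pi.mul_apply, norm_mul, mul_pow, smul_eq_mul]
            gcongr
            exact hf.2 ζ (sphere_subset_unitBall hr hζ)
      _ = M ^ 2 * circleAverage (fun ζ => ‖q ζ‖ ^ 2) 0 r := by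
          rw [circleAverage_fun_smul, smul_eq_mul]
      _ ≤ _ := mul_le_mul_of_nonneg_left (hq.2 r hr) (by positivity)
  refine ⟨((√(1 - ‖z j‖ ^ 2) : ℝ) : ℂ) • (f * q), boundedMeans_mono (le_of_eq ?_)
    (smul_mem_boundedMeans _ hfq), le_of_eq ?_, fun k hk => ?_⟩
  · rw [hs, mul_left_comm, mul_inv_cancel₀ (hw j).ne', mul_one]
  · have hqj : ‖q (z j)‖ = (1 - ‖z j‖ ^ 2)⁻¹ := by
      have : q (z j) = (((1 - ‖z j‖ ^ 2)⁻¹ : ℝ) : ℂ) := by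
        simp [q, Complex.conj_mul']
      rw [this, Complex.norm_real, Real.norm_of_nonneg (inv_nonneg.2 (hw j).le)]
    simp only [Pi.smul_apply, Pi.mul_apply, norm_smul, norm_mul, mul_pow, hs, hqj, hfj, hT,
      lp.single_apply_self, norm_one]
    field_simp [(hw j).ne']
  · simp [hfj, hT, Pi.single_eq_of_ne hk]

end CarlesonInterpolation

theorem stmt_4 (z : ℕ → ℂ) (hz : ∀ j, ‖z j‖ < 1) (hinj : Function.Injective z) :
    -- (a) H² interpolation
    ((∀ a : ℕ → ℂ, Summable (fun j => ‖a j‖ ^ 2 * (1 - ‖z j‖ ^ 2)) →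
        ∃ f : ℂ → ℂ, MemHardy2 f ∧ ∀ j, f (z j) = a j) ↔
      -- (b) H^∞ interpolation
      (∀ a : ℕ → ℂ, BddAbove (Set.range fun j => ‖a j‖) →
        ∃ f : ℂ → ℂ, DifferentiableOn ℂ f (Metric.ball 0 1) ∧
          (∃ B : ℝ, ∀ x ∈ Metric.ball (0 : ℂ) 1, ‖f x‖ ≤ B) ∧ ∀ j, f (z j) = a j)) ∧
    -- (b) ↔ (c) separation + Carleson measure
    ((∀ a : ℕ → ℂ, BddAbove (Set.range fun j => ‖a j‖) →
        ∃ f : ℂ → ℂ, DifferentiableOn ℂ f (Metric.ball 0 1) ∧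
          (∃ B : ℝ, ∀ x ∈ Metric.ball (0 : ℂ) 1, ‖f x‖ ≤ B) ∧ ∀ j, f (z j) = a j) ↔
      ((∃ δ : ℝ, 0 < δ ∧ ∀ j k, j ≠ k →
          δ ≤ ‖(z j - z k) / (1 - (starRingEnd ℂ) (z k) * z j)‖) ∧
        ∃ C : ℝ, 0 < C ∧ ∀ f : ℂ → ℂ, MemHardy2 f →
          ∀ s : Finset ℕ, ∑ j ∈ s, (1 - ‖z j‖ ^ 2) * ‖f (z j)‖ ^ 2 ≤ C * hardy2NormSq f)) ∧
    -- (c) ↔ (d) strong separation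
    (((∃ δ : ℝ, 0 < δ ∧ ∀ j k, j ≠ k →
          δ ≤ ‖(z j - z k) / (1 - (starRingEnd ℂ) (z k) * z j)‖) ∧
        ∃ C : ℝ, 0 < C ∧ ∀ f : ℂ → ℂ, MemHardy2 f →
          ∀ s : Finset ℕ, ∑ j ∈ s, (1 - ‖z j‖ ^ 2) * ‖f (z j)‖ ^ 2 ≤ C * hardy2NormSq f) ↔
      (∃ δ : ℝ, 0 < δ ∧ ∀ j, ∀ F : Finset ℕ, j ∉ F →
        δ ≤ ∏ k ∈ F, ‖(z j - z k) / (1 - (starRingEnd ℂ) (z k) * z j)‖)) := by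
  have hda : (∃ δ : ℝ, 0 < δ ∧ ∀ j, ∀ F : Finset ℕ, j ∉ F →
        δ ≤ ∏ k ∈ F, ‖(z j - z k) / (1 - (starRingEnd ℂ) (z k) * z j)‖) →
      ∀ a : ℕ → ℂ, Summable (fun j => ‖a j‖ ^ 2 * (1 - ‖z j‖ ^ 2)) →
        ∃ f : ℂ → ℂ, MemHardy2 f ∧ ∀ j, f (z j) = a j := by
    rintro ⟨δ, hδ, hd⟩ a ha
    obtain ⟨M, f, hf, hfa⟩ :=
      CarlesonInterpolation.exists_boundedMeans_interpolation hz hinj hδ hd ha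
    exact ⟨f, CarlesonInterpolation.memHardy2_of_mem_boundedMeans hf, hfa⟩
  have hdb : (∃ δ : ℝ, 0 < δ ∧ ∀ j, ∀ F : Finset ℕ, j ∉ F →
        δ ≤ ∏ k ∈ F, ‖(z j - z k) / (1 - (starRingEnd ℂ) (z k) * z j)‖) →
      ∀ a : ℕ → ℂ, BddAbove (Set.range fun j => ‖a j‖) →
        ∃ f : ℂ → ℂ, DifferentiableOn ℂ f (Metric.ball 0 1) ∧
          (∃ B : ℝ, ∀ x ∈ Metric.ball (0 : ℂ) 1, ‖f x‖ ≤ B) ∧ ∀ j, f (z j) = a j := by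
    rintro ⟨δ, hδ, hd⟩ a ⟨A, hA⟩
    obtain ⟨M, f, hf, hfa⟩ := CarlesonInterpolation.exists_boundedHolo_interpolation hz hinj hδ hd
      (a := a) (A := A) fun j => hA ⟨j, rfl⟩
    exact ⟨f, hf.1, ⟨M, hf.2⟩, hfa⟩
  have hdc : (∃ δ : ℝ, 0 < δ ∧ ∀ j, ∀ F : Finset ℕ, j ∉ F →
        δ ≤ ∏ k ∈ F, ‖(z j - z k) / (1 - (starRingEnd ℂ) (z k) * z j)‖) →
      (∃ δ : ℝ, 0 < δ ∧ ∀ j k, j ≠ k →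
          δ ≤ ‖(z j - z k) / (1 - (starRingEnd ℂ) (z k) * z j)‖) ∧
        ∃ C : ℝ, 0 < C ∧ ∀ f : ℂ → ℂ, MemHardy2 f →
          ∀ s : Finset ℕ, ∑ j ∈ s, (1 - ‖z j‖ ^ 2) * ‖f (z j)‖ ^ 2 ≤ C * hardy2NormSq f := by
    rintro ⟨δ, hδ, hd⟩
    refine ⟨⟨δ, hδ, fun j k hjk => by simpa using hd j {k} (by simpa using hjk)⟩,
      2 * (δ⁻¹ * Real.exp (2 * (1 - Real.log (δ ^ 2)))), by positivity, fun f hf s => ?_⟩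
    exact CarlesonInterpolation.sum_norm_sq_le_of_strongSeparation hz hinj hδ hd
      (CarlesonInterpolation.mem_boundedMeans_hardy2NormSq hf) s
  have had := CarlesonInterpolation.strongSeparation_of_hardy_interpolation hz hinj
  have hbd := CarlesonInterpolation.strongSeparation_of_bounded_interpolation hz hinj
  refine ⟨⟨fun h => hdb (had h), fun h => hda (hbd h)⟩, ⟨fun h => hdc (hbd h), fun h => hdb ?_⟩,
    ⟨fun h => ?_, hdc⟩⟩ <;>
  · obtain ⟨⟨δ, hδ, hsep⟩, C, hC, hemb⟩ := h
    exact ⟨_, Real.exp_pos _,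
      CarlesonInterpolation.strongSeparation_of_carleson hz hδ hsep hC hemb⟩
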